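/- arXiv:2110.14829 — 2 statements merged into one kernel-verified Lean document; each statement's English description precedes it below -/
import Mathlib

section
/- Let k be an uncountable algebraically closed field, let X be a scheme of finite type over k, and let E_0 ⊇ E_1 ⊇ E_2 ⊇ ⋯ be a descending sequence of nonempty constructible subsets of X. Then there exists a k-rational point x ∈ X(k) lying in E_r for every r ≥ 0. -/
open AlgebraicGeometry CategoryTheory

/-- A subset of a topological space is *constructible* if it is a finite union of
locally closed subsets. -/
def IsConstructibleSet {X : Type*} [TopologicalSpace X] (s : Set X) : Prop :=
  ∃ S : Finset (Set X), (∀ t ∈ S, IsLocallyClosed t) ∧ s = ⋃ t ∈ S, t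

/-- The unique point of the spectrum of a field. -/
def specFieldPt (k : Type) [Field k] : Spec (CommRingCat.of k) :=
  ⟨⊥, Ideal.bot_prime⟩

open Cardinal in
/-- A countably generated field extension, as an algebra over an uncountable field, is algebraic. -/
theorem MvPolynomial.isAlgebraic_of_surjective {k L ι : Type*} [Field k] [Uncountable k]
    [Field L] [Algebra k L] [Countable ι] (ψ : MvPolynomial ι k →ₐ[k] L)
    (hψ : Function.Surjective ψ) : Algebra.IsAlgebraic k L := by
  refine ⟨fun x ↦ by_contra fun hx ↦ ?_⟩
  have h₁ := (Transcendental.linearIndependent_sub_inv hx).cardinal_lift_le_rank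
  have h₂ := LinearMap.lift_rank_le_of_surjective ψ.toLinearMap hψ
  have h₃ : Module.rank k (MvPolynomial ι k) ≤ ℵ₀ := by
    rw [MvPolynomial.rank_eq_lift]
    simp
  have h₄ : Module.rank k L ≤ ℵ₀ := by
    rw [← lift_le_aleph0]
    exact h₂.trans (lift_le_aleph0.2 h₃)
  have h₅ : #k ≤ ℵ₀ := lift_le_aleph0.1 (h₁.trans (lift_le_aleph0.2 h₄))
  exact not_countable (mk_le_aleph0_iff.1 h₅)

/-- A nonzero countably generated algebra over an uncountable algebraically closed field `k`
admits a `k`-algebra homomorphism to `k`. -/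
theorem MvPolynomial.nonempty_algHom_of_surjective {k C ι : Type*} [Field k] [IsAlgClosed k]
    [Uncountable k] [CommRing C] [Nontrivial C] [Algebra k C] [Countable ι]
    (ψ : MvPolynomial ι k →ₐ[k] C) (hψ : Function.Surjective ψ) : Nonempty (C →ₐ[k] k) := by
  obtain ⟨m, hm⟩ := Ideal.exists_maximal C
  let _ : Field (C ⧸ m) := Ideal.Quotient.field m
  have : Algebra.IsAlgebraic k (C ⧸ m) := isAlgebraic_of_surjective
    ((Ideal.Quotient.mkₐ k m).comp ψ) ((Ideal.Quotient.mkₐ_surjective k m).comp hψ)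
  let e := AlgEquiv.ofBijective (Algebra.ofId k (C ⧸ m))
    (IsAlgClosed.algebraMap_bijective_of_isIntegral (k := k))
  exact ⟨e.symm.toAlgHom.comp (Ideal.Quotient.mkₐ k m)⟩

/-- Countably many nonzero elements of a domain of finite type over an uncountable
algebraically closed field are simultaneously nonzero at some rational point. -/
theorem Algebra.FiniteType.exists_algHom_forall_ne_zero {k B : Type*} [Field k] [IsAlgClosed k]
    [Uncountable k] [CommRing B] [IsDomain B] [Algebra k B] [Algebra.FiniteType k B]
    {ι : Type*} [Countable ι] (g : ι → B) (hg : ∀ i, g i ≠ 0) :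
    ∃ φ : B →ₐ[k] k, ∀ i, φ (g i) ≠ 0 := by
  obtain ⟨n, p, hp⟩ := Algebra.FiniteType.iff_quotient_mvPolynomial''.1 ‹Algebra.FiniteType k B›
  let K := FractionRing B
  let a : B →ₐ[k] K := IsScalarTower.toAlgHom k B K
  let v : Fin n ⊕ ι → K := Sum.elim (fun i ↦ a (p (.X i))) (fun i ↦ (a (g i))⁻¹)
  let θ : MvPolynomial (Fin n ⊕ ι) k →ₐ[k] K := MvPolynomial.aeval v
  have ha (b : B) : a b ∈ θ.range := by
    obtain ⟨q, rfl⟩ := hp b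
    refine ⟨MvPolynomial.rename Sum.inl q, ?_⟩
    have : (θ.comp (MvPolynomial.rename Sum.inl)) = a.comp p := by
      ext i
      simp [θ, v]
    exact congr($this q)
  obtain ⟨χ⟩ :=
    MvPolynomial.nonempty_algHom_of_surjective θ.rangeRestrict θ.rangeRestrict_surjective
  refine ⟨χ.comp (a.codRestrict θ.range ha), fun i hi ↦ ?_⟩
  have hinv : (a (g i))⁻¹ ∈ θ.range := ⟨.X (.inr i), by simp [θ, v]⟩
  have hne : a (g i) ≠ 0 := by
    simpa [a] using hg i
  have hmul : a.codRestrict θ.range ha (g i) * ⟨_, hinv⟩ = 1 :=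
    Subtype.ext (mul_inv_cancel₀ hne)
  have := congr(χ $hmul)
  rw [map_mul, map_one] at this
  simp_all

theorem Algebra.FiniteType.exists_algHom_ker_ge_forall_ne_zero {k A : Type*} [Field k]
    [IsAlgClosed k] [Uncountable k] [CommRing A] [Algebra k A] [Algebra.FiniteType k A]
    (P : Ideal A) [P.IsPrime] {ι : Type*} [Countable ι] (g : ι → A) (hg : ∀ i, g i ∉ P) :
    ∃ φ : A →ₐ[k] k, P ≤ RingHom.ker φ ∧ ∀ i, φ (g i) ≠ 0 := by
  obtain ⟨φ, hφ⟩ := exists_algHom_forall_ne_zero (k := k) (fun i ↦ Ideal.Quotient.mk P (g i))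
    (fun i ↦ by simpa [Ideal.Quotient.eq_zero_iff_mem] using hg i)
  refine ⟨φ.comp (Ideal.Quotient.mkₐ k P), fun x hx ↦ ?_, hφ⟩
  have : Ideal.Quotient.mk P x = 0 := Ideal.Quotient.eq_zero_iff_mem.2 hx
  simp [RingHom.mem_ker, this]

open Topology TopologicalSpace in
theorem IsConstructibleSet.isClosed_constructibleTopology {X : Type*} [TopologicalSpace X]
    [TopologicalSpace.NoetherianSpace X] {s : Set X} (hs : IsConstructibleSet s) :
    IsClosed[constructibleTopology X] s := by
  obtain ⟨S, hS, rfl⟩ := hs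
  have hclosed (t) (ht : t ∈ S) : IsClosed[constructibleTopology X] t := by
    obtain ⟨U, Z, hU, hZ, rfl⟩ := hS t ht
    have hU' : IsOpen[constructibleTopology X] Uᶜ :=
      (NoetherianSpace.isCompact _).isOpen_constructibleTopology_of_isClosed hU.isClosed_compl
    have hZ' : IsOpen[constructibleTopology X] Zᶜ :=
      (NoetherianSpace.isCompact _).isOpen_constructibleTopology_of_isOpen hZ.isOpen_compl
    let _ := constructibleTopology X
    exact (isOpen_compl_iff.1 hU').inter (isOpen_compl_iff.1 hZ')
  let _ := constructibleTopology X
  exact S.finite_toSet.isClosed_biUnion hclosed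

theorem IsConstructibleSet.nonempty_iInter {X : Type*} [TopologicalSpace X]
    [TopologicalSpace.NoetherianSpace X] [QuasiSober X] {E : ℕ → Set X}
    (hE : ∀ r, IsConstructibleSet (E r)) (hdesc : ∀ r, E (r + 1) ⊆ E r)
    (hne : ∀ r, (E r).Nonempty) : (⋂ r, E r).Nonempty := by
  have : QuasiSeparatedSpace X :=
    ⟨fun _ _ _ _ _ _ ↦ TopologicalSpace.NoetherianSpace.isCompact _⟩
  have hc : @CompactSpace X (constructibleTopology X) :=
    @Function.Surjective.compactSpace _ _ _ (constructibleTopology X) _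
      (WithTopology.continuous_ofTopology _) _ (WithTopology.ofTopology_surjective _)
  have hcl (r) := (hE r).isClosed_constructibleTopology
  let _ := constructibleTopology X
  exact IsCompact.nonempty_iInter_of_sequence_nonempty_isCompact_isClosed E hdesc hne
    (hcl 0).isCompact hcl

/-- A constructible set containing `y` contains all specializations of `y` in some open
neighbourhood of `y`. -/
theorem IsConstructibleSet.exists_isOpen_forall_specializes {X : Type*} [TopologicalSpace X]
    {s : Set X} (hs : IsConstructibleSet s) {y : X} (hy : y ∈ s) :
    ∃ U, IsOpen U ∧ y ∈ U ∧ ∀ z ∈ U, y ⤳ z → z ∈ s := by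
  obtain ⟨S, hS, rfl⟩ := hs
  simp only [Set.mem_iUnion, exists_prop] at hy
  obtain ⟨t, ht, hyt⟩ := hy
  obtain ⟨U, Z, hU, hZ, rfl⟩ := hS t ht
  exact ⟨U, hU, hyt.1, fun z hz hyz ↦ Set.mem_biUnion ht ⟨hz, hyz.mem_closed hZ hyt.2⟩⟩

/-- Over an uncountable algebraically closed field `k`, given a scheme `X` of finite type
over `k` and a descending sequence of nonempty constructible subsets `E r ⊆ X`, there is a
`k`-rational point of `X` (a section of the structure morphism) lying in every `E r`. -/
theorem exists_rational_point_in_descending_constructible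
    (k : Type) [Field k] [IsAlgClosed k] [Uncountable k]
    (X : Scheme) (f : X ⟶ Spec (CommRingCat.of k))
    (hft : LocallyOfFiniteType f) (hqc : QuasiCompact f)
    (E : ℕ → Set X)
    (hdesc : ∀ r : ℕ, E (r + 1) ⊆ E r)
    (hne : ∀ r : ℕ, (E r).Nonempty)
    (hcon : ∀ r : ℕ, IsConstructibleSet (E r)) :
    ∃ x : Spec (CommRingCat.of k) ⟶ X,
      x ≫ f = 𝟙 (Spec (CommRingCat.of k)) ∧
      ∀ r : ℕ, x.base (specFieldPt k) ∈ E r := by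
  have : IsLocallyNoetherian X := LocallyOfFiniteType.isLocallyNoetherian f
  have : CompactSpace X := QuasiCompact.compactSpace_of_compactSpace f
  have : IsNoetherian X := {}
  obtain ⟨y, hy⟩ := IsConstructibleSet.nonempty_iInter hcon hdesc hne
  rw [Set.mem_iInter] at hy
  obtain ⟨A, j, _, ⟨P, rfl⟩, -⟩ :=
    X.exists_affine_mem_range_and_range_subset (U := ⊤) (x := y) trivial
  obtain ⟨ψ, hψ⟩ := Spec.map_surjective (j ≫ f)
  have hψft : ψ.hom.FiniteType := by
    rw [← HasRingHomProperty.Spec_iff (P := @LocallyOfFiniteType), hψ]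
    infer_instance
  algebraize [ψ.hom]
  have hbasic (r : ℕ) : ∃ g : A, g ∉ P.asIdeal ∧
      ∀ Q : PrimeSpectrum A, P.asIdeal ≤ Q.asIdeal → g ∉ Q.asIdeal → j Q ∈ E r := by
    obtain ⟨U, hU, hPU, hUE⟩ := (hcon r).exists_isOpen_forall_specializes (hy r)
    obtain ⟨_, ⟨g, rfl⟩, hg, hgU⟩ :=
      PrimeSpectrum.isTopologicalBasis_basic_opens.exists_subset_of_mem_open
        (show P ∈ j ⁻¹' U from hPU) (hU.preimage j.continuous)
    exact ⟨g, hg, fun Q hPQ hgQ ↦ hUE _ (hgU hgQ)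
      (((PrimeSpectrum.le_iff_specializes P Q).1 hPQ).map j.continuous)⟩
  have : P.asIdeal.IsPrime := P.isPrime
  choose g hgP hgE using hbasic
  obtain ⟨φ, hPφ, hφg⟩ :=
    Algebra.FiniteType.exists_algHom_ker_ge_forall_ne_zero (k := k) P.asIdeal g hgP
  refine ⟨Spec.map (CommRingCat.ofHom φ.toRingHom) ≫ j, ?_, fun r ↦ ?_⟩
  · rw [Category.assoc, ← hψ, ← Spec.map_comp, ← Spec.map_id]
    congr 1
    ext x
    exact φ.commutes x
  · exact hgE r (PrimeSpectrum.comap φ.toRingHom (specFieldPt k)) hPφ (hφg r)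
end

section
/- Let K be a field, let X be a scheme of finite type over K, let x ∈ X be a K-rational point, and let R = O_{X,x} be the local ring of X at x, with maximal ideal m. Fix an integer d ≥ 1. Suppose that for every r ≥ 1 there exists a K-algebra homomorphism φ_r : R → K[t_1,…,t_d]/(t_1,…,t_d)^{r+1} such that the induced K-linear map on cotangent spaces m/m² → (t_1,…,t_d)/(t_1,…,t_d)² is surjective. Then the Krull dimension of R is at least d. -/
/-- The coordinate ring `A^d_r = K[t_1,…,t_d]/(t_1,…,t_d)^{r+1}` of the `d`-dimensional
disk of order `r`. -/
abbrev DiskAlg (K : Type*) [Field K] (d r : ℕ) : Type _ :=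
  MvPolynomial (Fin d) K ⧸
    ((Ideal.span (Set.range MvPolynomial.X) : Ideal (MvPolynomial (Fin d) K)) ^ (r + 1))

/-- The maximal ideal `(t_1,…,t_d)` of `A^d_r`. -/
noncomputable def DiskAlg.maxIdeal (K : Type*) [Field K] (d r : ℕ) : Ideal (DiskAlg K d r) :=
  Ideal.map (Ideal.Quotient.mk _) (Ideal.span (Set.range MvPolynomial.X))

/-- The `K`-span of the monomials in the family `y` all of whose exponents are at most `n`. -/
def boxMonomialSpan (K : Type*) {A ι : Type*} [Field K] [CommRing A] [Algebra K A] [Fintype ι]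
    (y : ι → A) (n : ℕ) : Submodule K A :=
  Submodule.span K (Set.range fun a : ι → Fin (n + 1) => ∏ i, y i ^ (a i : ℕ))

section boxMonomialSpan

variable {K A ι : Type*} [Field K] [CommRing A] [Algebra K A] [Fintype ι]

instance (y : ι → A) (n : ℕ) : Module.Finite K (boxMonomialSpan K y n) :=
  Module.Finite.span_of_finite K (Set.finite_range _)

theorem finrank_boxMonomialSpan_le (y : ι → A) (n : ℕ) :
    Module.finrank K (boxMonomialSpan K y n) ≤ (n + 1) ^ Fintype.card ι := by
  classical
  refine (finrank_range_le_card (R := K) fun a : ι → Fin (n + 1) =>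
    ∏ i, y i ^ (a i : ℕ)).trans_eq ?_
  simp

theorem one_mem_boxMonomialSpan (y : ι → A) (n : ℕ) : (1 : A) ∈ boxMonomialSpan K y n :=
  Submodule.subset_span ⟨0, by simp⟩

theorem mul_mem_boxMonomialSpan_succ (y : ι → A) {n : ℕ} (i : ι) {t : A}
    (ht : t ∈ boxMonomialSpan K y n) : y i * t ∈ boxMonomialSpan K y (n + 1) := by
  classical
  induction ht using Submodule.span_induction with
  | mem x hx =>
    obtain ⟨a, rfl⟩ := hx
    refine Submodule.subset_span
      ⟨fun j => ⟨(a j : ℕ) + if j = i then 1 else 0, by have := (a j).2; split_ifs <;> omega⟩, ?_⟩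
    simp only [pow_add, Finset.prod_mul_distrib, mul_comm (y i)]
    simp [pow_ite]
  | zero => simp
  | add u v _ _ hu hv => rw [mul_add]; exact add_mem hu hv
  | smul c u _ hu => rw [mul_smul_comm]; exact Submodule.smul_mem _ c hu

theorem boxMonomialSpan_le_toSubmodule (y : ι → A) (n : ℕ) (B : Subalgebra K A)
    (hy : ∀ i, y i ∈ B) : boxMonomialSpan K y n ≤ Subalgebra.toSubmodule B := by
  refine Submodule.span_le.mpr ?_
  rintro _ ⟨a, rfl⟩
  exact B.prod_mem fun i _ => pow_mem (hy i) _

/-- If `V` spans `A` modulo the ideal `(y)`, then the products of elements of `V` with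
monomials in `y` of bounded exponents span `A` modulo `(y) ^ n`. -/
theorem boxMonomialSpan_mul_sup_pow_eq_top (y : ι → A) (V : Submodule K A)
    (hV : V ⊔ (Ideal.span (Set.range y)).restrictScalars K = ⊤) (n : ℕ) :
    boxMonomialSpan K y n * V ⊔ (Ideal.span (Set.range y) ^ n).restrictScalars K = ⊤ := by
  induction n with
  | zero => simp
  | succ n ih =>
    rw [eq_top_iff, ← hV]
    refine sup_le (fun v hv => Submodule.mem_sup_left ?_) fun x hx => ?_
    · simpa only [one_mul] using
        Submodule.mul_mem_mul (one_mem_boxMonomialSpan (K := K) y (n + 1)) hv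
    · obtain ⟨c, rfl⟩ := (Submodule.mem_span_range_iff_exists_fun A).mp hx
      refine sum_mem fun i _ => ?_
      obtain ⟨u, hu, w, hw, huw⟩ := Submodule.mem_sup.mp (ih ▸ Submodule.mem_top (x := c i))
      rw [← huw, smul_eq_mul, add_mul, mul_comm u, mul_comm w]
      refine add_mem (Submodule.mem_sup_left ?_) (Submodule.mem_sup_right ?_)
      · refine Submodule.mul_induction_on hu (fun t ht v hv => ?_) fun a b ha hb => ?_
        · rw [← mul_assoc]
          exact Submodule.mul_mem_mul (mul_mem_boxMonomialSpan_succ y i ht) hv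
        · rw [mul_add]
          exact add_mem ha hb
      · rw [Submodule.restrictScalars_mem, pow_succ']
        exact Ideal.mul_mem_mul (Ideal.subset_span ⟨i, rfl⟩) hw

theorem Submodule.finrank_mul_le (S T : Submodule K A) [Module.Finite K S] [Module.Finite K T] :
    Module.finrank K ↥(S * T) ≤ Module.finrank K S * Module.finrank K T := by
  rw [← Submodule.mulMap_range, ← Module.finrank_tensorProduct]
  exact LinearMap.finrank_range_le _

end boxMonomialSpan

/-- If the residue field of a local `K`-algebra is `K`, then the quotient by an ideal primary to
the maximal ideal is spanned by a finite-dimensional subspace. -/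
theorem exists_finite_sup_eq_top_of_mem_minimalPrimes {K R : Type*} [Field K] [CommRing R]
    [IsLocalRing R] [Algebra K R] [IsNoetherianRing R]
    (hrat : Function.Surjective (algebraMap K (IsLocalRing.ResidueField R))) {q : Ideal R}
    (hq : IsLocalRing.maximalIdeal R ∈ q.minimalPrimes) :
    ∃ W : Submodule K R, Module.Finite K W ∧ W ⊔ q.restrictScalars K = ⊤ := by
  obtain ⟨n, x, hx⟩ := Submodule.fg_iff_exists_fin_generating_family.mp
    (IsNoetherian.noetherian (IsLocalRing.maximalIdeal R))
  replace hx : Ideal.span (Set.range x) = IsLocalRing.maximalIdeal R := hx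
  have hrad : IsLocalRing.maximalIdeal R ≤ q.radical := by
    rw [Ideal.radical_eq_sInf]
    refine le_sInf fun p hp => ?_
    have := hp.2
    exact hq.2 ⟨hp.2, hp.1⟩ (IsLocalRing.le_maximalIdeal this.ne_top)
  obtain ⟨k, hk⟩ := Ideal.exists_pow_le_of_le_radical_of_fg hrad (IsNoetherian.noetherian _)
  have h₁ : (1 : Submodule K R) ⊔ (Ideal.span (Set.range x)).restrictScalars K = ⊤ := by
    refine eq_top_iff.mpr fun a _ => ?_
    obtain ⟨c, hc⟩ := hrat (IsLocalRing.residue R a)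
    rw [← add_sub_cancel (algebraMap K R c) a]
    refine add_mem (Submodule.mem_sup_left (Submodule.algebraMap_mem c))
      (Submodule.mem_sup_right ?_)
    rw [Submodule.restrictScalars_mem, hx, ← IsLocalRing.residue_eq_zero_iff, map_sub, ← hc,
      sub_eq_zero]
    rfl
  have h₂ := boxMonomialSpan_mul_sup_pow_eq_top (K := K) x 1 h₁ k
  refine ⟨boxMonomialSpan K x k, inferInstance, eq_top_iff.mpr ?_⟩
  rw [← h₂, mul_one, hx]
  exact sup_le_sup le_rfl hk

namespace DiskAlg

theorem pow_le_finrank {K : Type*} [Field K] {d r s : ℕ} (h : d * s ≤ r)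
    [Module.Finite K (DiskAlg K d r)] :
    (s + 1) ^ d ≤ Module.finrank K (DiskAlg K d r) := by
  classical
  let e : (Fin d → Fin (s + 1)) → (Fin d →₀ ℕ) := fun a =>
    Finsupp.equivFunOnFinite.symm fun i => a i
  have he : Function.Injective e := fun a b hab => by
    ext i
    exact DFunLike.congr_fun hab i
  have hdeg (a) : (e a).degree ≤ r := by
    rw [Finsupp.degree_eq_sum]
    refine (Finset.sum_le_card_nsmul _ _ s fun i _ => ?_).trans (by simpa using h)
    exact Nat.lt_succ_iff.mp (a i).2
  let v : (Fin d → Fin (s + 1)) → DiskAlg K d r := fun a =>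
    Ideal.Quotient.mkₐ K _ (MvPolynomial.monomial (e a) 1)
  have hv : LinearIndependent K v := by
    rw [Fintype.linearIndependent_iff]
    intro g hg a
    have hmem : ∑ b, g b • MvPolynomial.monomial (e b) (1 : K) ∈
        MvPolynomial.idealOfVars (Fin d) K ^ (r + 1) := by
      rw [← Ideal.Quotient.eq_zero_iff_mem, ← Ideal.Quotient.mkₐ_eq_mk K, ← hg, map_sum]
      simp only [map_smul, v]
    have := (MvPolynomial.mem_pow_idealOfVars_iff' _ _).mp hmem (e a)
      (Nat.lt_succ_iff.mpr (hdeg a))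
    simpa [MvPolynomial.coeff_sum, MvPolynomial.coeff_monomial, he.eq_iff] using this
  simpa using hv.fintype_card_le_finrank

theorem maxIdeal_eq_span (K : Type*) [Field K] (d r : ℕ) :
    maxIdeal K d r =
      Ideal.span (Set.range fun i => Ideal.Quotient.mk _ (MvPolynomial.X i)) := by
  rw [maxIdeal, Ideal.map_span, ← Set.range_comp]
  rfl

theorem maxIdeal_pow (K : Type*) [Field K] (d r : ℕ) : maxIdeal K d r ^ (r + 1) = ⊥ := by
  rw [maxIdeal, ← Ideal.map_pow, Ideal.map_quotient_self]

theorem one_sup_maxIdeal (K : Type*) [Field K] (d r : ℕ) :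
    (1 : Submodule K (DiskAlg K d r)) ⊔ (maxIdeal K d r).restrictScalars K = ⊤ := by
  refine eq_top_iff.mpr fun a _ => ?_
  obtain ⟨p, rfl⟩ := Ideal.Quotient.mk_surjective a
  induction p using MvPolynomial.induction_on with
  | C c => exact Submodule.mem_sup_left (Submodule.algebraMap_mem c)
  | add p q hp hq => rw [map_add]; exact add_mem (hp trivial) (hq trivial)
  | mul_X p i _ =>
    refine Submodule.mem_sup_right ?_
    rw [map_mul, Submodule.restrictScalars_mem, maxIdeal_eq_span]
    exact Ideal.mul_mem_left _ _ (Ideal.subset_span ⟨i, rfl⟩)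

/-- A nondegenerate jet is surjective on coordinate rings. -/
theorem surjective_of_cotangent {K R : Type*} [Field K] [CommRing R] [Algebra K R]
    {d r : ℕ} (φ : R →ₐ[K] DiskAlg K d r)
    (h : ∀ a ∈ maxIdeal K d r, ∃ b, φ b ∈ maxIdeal K d r ∧ φ b - a ∈ maxIdeal K d r ^ 2) :
    Function.Surjective φ := by
  have hX (i : Fin d) : Ideal.Quotient.mk _ (MvPolynomial.X i) ∈ maxIdeal K d r := by
    rw [maxIdeal_eq_span]
    exact Ideal.subset_span ⟨i, rfl⟩
  choose b hb hbX using fun i => h _ (hX i)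
  have hspan : Ideal.span (Set.range fun i => φ (b i)) = maxIdeal K d r := by
    refine le_antisymm (Ideal.span_le.mpr (Set.range_subset_iff.mpr hb)) ?_
    refine Submodule.le_of_le_smul_of_le_jacobson_bot (I := maxIdeal K d r)
      (IsNoetherian.noetherian _) (fun x hx => ?_) ?_
    · refine Ideal.radical_le_jacobson ⟨r + 1, ?_⟩
      rw [← maxIdeal_pow K d r]
      exact Ideal.pow_mem_pow hx _
    · conv_lhs => rw [maxIdeal_eq_span]
      rw [Ideal.span_le, smul_eq_mul, ← sq]
      rintro _ ⟨i, rfl⟩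
      beta_reduce
      rw [← sub_sub_self (φ (b i)) (Ideal.Quotient.mk _ (MvPolynomial.X i))]
      exact sub_mem (Submodule.mem_sup_left (Ideal.subset_span ⟨i, rfl⟩))
        (Submodule.mem_sup_right (hbX i))
  have htop := boxMonomialSpan_mul_sup_pow_eq_top (K := K) (fun i => φ (b i)) 1
    (by rw [hspan, one_sup_maxIdeal]) (r + 1)
  rw [hspan, maxIdeal_pow, Submodule.restrictScalars_bot, sup_bot_eq, mul_one] at htop
  intro a
  exact boxMonomialSpan_le_toSubmodule _ _ φ.range (fun i => ⟨b i, rfl⟩)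
    (htop ▸ Submodule.mem_top (x := a))

/-- If the finite-dimensional subspace `W` spans `R` modulo the ideal `(y)`, then the dimension of
a disk algebra is bounded by any surjection from `R` onto it that sends `y` into the maximal
ideal. -/
theorem finite_and_finrank_le {K R ι : Type*} [Field K] [CommRing R] [Algebra K R] [Fintype ι]
    {d r : ℕ} (φ : R →ₐ[K] DiskAlg K d r) (hφ : Function.Surjective φ) (y : ι → R)
    (hy : ∀ i, φ (y i) ∈ maxIdeal K d r) (W : Submodule K R) [Module.Finite K W]
    (hW : W ⊔ (Ideal.span (Set.range y)).restrictScalars K = ⊤) :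
    Module.Finite K (DiskAlg K d r) ∧
      Module.finrank K (DiskAlg K d r) ≤ (r + 2) ^ Fintype.card ι * Module.finrank K W := by
  have hV : W.map φ.toLinearMap ⊔
      (Ideal.span (Set.range fun i => φ (y i))).restrictScalars K = ⊤ := by
    refine eq_top_iff.mpr fun a _ => ?_
    obtain ⟨x, rfl⟩ := hφ a
    obtain ⟨w, hw, z, hz, rfl⟩ := Submodule.mem_sup.mp (hW ▸ Submodule.mem_top (x := x))
    rw [map_add]
    refine add_mem (Submodule.mem_sup_left ⟨w, hw, rfl⟩) (Submodule.mem_sup_right ?_)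
    have := Ideal.mem_map_of_mem φ hz
    rwa [Ideal.map_span, ← Set.range_comp] at this
  have hpow : Ideal.span (Set.range fun i => φ (y i)) ^ (r + 1) = ⊥ := by
    rw [eq_bot_iff, ← maxIdeal_pow K d r]
    exact Ideal.pow_right_mono (Ideal.span_le.mpr (Set.range_subset_iff.mpr hy)) _
  have htop := boxMonomialSpan_mul_sup_pow_eq_top _ _ hV (r + 1)
  rw [hpow, Submodule.restrictScalars_bot, sup_bot_eq] at htop
  refine ⟨⟨htop ▸ ?_⟩, ?_⟩
  · exact (Module.Finite.iff_fg.mp inferInstance).mul (Module.Finite.iff_fg.mp inferInstance)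
  · rw [← finrank_top, ← htop]
    exact (Submodule.finrank_mul_le _ _).trans
      (Nat.mul_le_mul (finrank_boxMonomialSpan_le _ _) (Submodule.finrank_map_le _ _))

end DiskAlg

/-- Let `R = O_{X,x}` be the local ring of a finite type `K`-scheme at a `K`-rational point
(equivalently: a local `K`-algebra, essentially of finite type over `K`, with residue field
`K`).  If for every `r ≥ 1` there is a `K`-algebra homomorphism
`φ : R → K[t_1,…,t_d]/(t_1,…,t_d)^{r+1}` inducing a surjection on cotangent spaces
(a nondegenerate `d`-dimensional jet of order `r`), then the Krull dimension of `R`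
is at least `d`. -/
theorem krullDim_ge_of_nondegenerate_jets
    (K : Type*) [Field K] (R : Type*) [CommRing R] [IsLocalRing R] [Algebra K R]
    [Algebra.EssFiniteType K R]
    (hrat : Function.Bijective (algebraMap K (IsLocalRing.ResidueField R)))
    (d : ℕ) (hd : 1 ≤ d)
    (hjets : ∀ r : ℕ, 1 ≤ r →
      ∃ φ : R →ₐ[K] DiskAlg K d r,
        (∀ b ∈ IsLocalRing.maximalIdeal R, φ b ∈ DiskAlg.maxIdeal K d r) ∧
        (∀ a ∈ DiskAlg.maxIdeal K d r, ∃ b ∈ IsLocalRing.maximalIdeal R,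
          φ b - a ∈ (DiskAlg.maxIdeal K d r) ^ 2)) :
    (d : WithBot ℕ∞) ≤ ringKrullDim R := by
  have : IsNoetherianRing R := Algebra.EssFiniteType.isNoetherianRing K R
  obtain ⟨S, hS, hcard⟩ := Ideal.exists_finset_card_eq_height_of_isNoetherianRing
    (IsLocalRing.maximalIdeal R)
  obtain ⟨W, hWfin, hW⟩ := exists_finite_sup_eq_top_of_mem_minimalPrimes hrat.2 hS
  rw [← IsLocalRing.maximalIdeal_height_eq_ringKrullDim, ← hcard]
  norm_cast
  by_contra! hlt
  set c := (d + 3) ^ S.card * Module.finrank K W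
  obtain ⟨φ, hφ, hφ'⟩ := hjets (d * c + 1) (by omega)
  have hsurj := DiskAlg.surjective_of_cotangent φ fun a ha =>
    (hφ' a ha).imp fun b hb => ⟨hφ b hb.1, hb.2⟩
  obtain ⟨_, hle⟩ := DiskAlg.finite_and_finrank_le φ hsurj ((↑) : S → R)
    (fun i => hφ _ (hS.1.2 (Ideal.subset_span i.2))) W (by simpa using hW)
  have hge := DiskAlg.pow_le_finrank (K := K) (d := d) (Nat.le_succ (d * c))
  rw [Fintype.card_coe] at hle
  have key : (c + 1) ^ (S.card + 1) ≤ (c + 1) ^ S.card * c :=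
    calc (c + 1) ^ (S.card + 1) ≤ (c + 1) ^ d := Nat.pow_le_pow_right (by omega) hlt
      _ ≤ (d * c + 1 + 2) ^ S.card * Module.finrank K W := hge.trans hle
      _ ≤ ((d + 3) * (c + 1)) ^ S.card * Module.finrank K W := by
        gcongr
        nlinarith
      _ = (c + 1) ^ S.card * c := by rw [mul_pow]; ring
  rw [pow_succ] at key
  have := Nat.le_of_mul_le_mul_left key (by positivity)
  omega
end
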